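/- arXiv:2308.00311 — 2 statements merged into one kernel-verified Lean document; each statement's English description precedes it below -/
import Mathlib

section
/- (Proposition 1) Let ℓ_i, ℓ'_i : ℝ^d × ℝ^p → ℝ for i = 1,…,M with each ℓ'_i twice continuously differentiable, let r > 0 and c > 0, let A_i = (I_p, −I_p)^⊤ ∈ ℝ^{2p×p} with rows a_k and b_i ∈ ℝ^{2p} with entries b_k, and let δ̂*_i : ℝ^d → ℝ^p be differentiable maps satisfying, for every θ, the barrier stationarity ∇_δ ℓ'_i(θ, δ̂*_i(θ)) + c ∑_{k=1}^{2p} a_k/(b_k − a_k^⊤ δ̂*_i(θ)) = 0 with b_k − a_k^⊤ δ̂*_i(θ) > 0. Define γ_k = 1/(b_k − a_k^⊤ δ̂*_i(θ))², C_i(θ) = c·diag(γ_1 + γ_{p+1}, …, γ_p + γ_{2p}), g_i(θ, δ) = exp(ℓ_i(θ, δ)/r), and L(θ) = r·log((1/M) ∑_{i=1}^M g_i(θ, δ̂*_i(θ))). If each matrix ∇²_δ ℓ'_i(θ, δ̂*_i(θ)) + C_i(θ) is invertible and each ℓ_i is differentiable, then L is differentiable at θ and ∇L(θ) = r · [∑_{i=1}^M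 ( ∇_θ g_i(θ, δ̂*_i(θ)) − ∇_θ∇_δ ℓ'_i(θ, δ̂*_i(θ)) [∇²_δ ℓ'_i(θ, δ̂*_i(θ)) + C_i(θ)]^{−1} ∇_δ g_i(θ, δ̂*_i(θ)) )] / [∑_{i=1}^M g_i(θ, δ̂*_i(θ))]. -/
open Finset

open scoped RealInnerProductSpace

/-- `diagCLM v` is the diagonal operator on `EuclideanSpace ℝ (Fin p)` with
diagonal entries `v`. -/
noncomputable def diagCLM {p : ℕ} (v : Fin p → ℝ) :
    EuclideanSpace ℝ (Fin p) →L[ℝ] EuclideanSpace ℝ (Fin p) :=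
  LinearMap.toContinuousLinearMap (Matrix.toEuclideanLin (Matrix.diagonal v))

theorem diagCLM_apply {p : ℕ} (v : Fin p → ℝ) (x : EuclideanSpace ℝ (Fin p)) (j : Fin p) :
    diagCLM v x j = v j * x j := by
  simp [diagCLM, Matrix.toLpLin_apply, Matrix.mulVec_diagonal]

theorem diagCLM_inner_comm {p : ℕ} (v : Fin p → ℝ) (x y : EuclideanSpace ℝ (Fin p)) :
    inner ℝ (diagCLM v x) y = inner ℝ x (diagCLM v y) := by
  simp only [PiLp.inner_apply, diagCLM_apply, RCLike.inner_apply, conj_trivial]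
  exact Finset.sum_congr rfl fun j _ => by ring

section Calculus

variable {E F G : Type*} [NormedAddCommGroup E] [NormedSpace ℝ E]

/-- Total derivative along a graph, in terms of partial derivatives. -/
theorem hasFDerivAt_comp_graph [NormedAddCommGroup F] [NormedSpace ℝ F]
    [NormedAddCommGroup G] [NormedSpace ℝ G] {f : E → F → G} {s : E → F} {x : E}
    {A : E →L[ℝ] G} {B : F →L[ℝ] G} {D : E →L[ℝ] F}
    (hf : DifferentiableAt ℝ (fun z : E × F => f z.1 z.2) (x, s x))
    (hA : HasFDerivAt (fun t => f t (s x)) A x) (hB : HasFDerivAt (f x) B (s x))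
    (hs : HasFDerivAt s D x) :
    HasFDerivAt (fun t => f t (s t)) (A + B ∘L D) x := by
  obtain ⟨T, hT⟩ := hf
  have hA' : A = T ∘L ContinuousLinearMap.inl ℝ E F :=
    hA.unique (HasFDerivAt.comp x (f := fun t => (t, s x)) hT (hasFDerivAt_prodMk_left x (s x)))
  have hB' : B = T ∘L ContinuousLinearMap.inr ℝ E F :=
    hB.unique (HasFDerivAt.comp (s x) (f := fun y => (x, y)) hT (hasFDerivAt_prodMk_right x (s x)))
  have h : HasFDerivAt (fun t => f t (s t)) (T ∘L (ContinuousLinearMap.id ℝ E).prod D) x :=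
    HasFDerivAt.comp x (f := fun t => (t, s t)) hT ((hasFDerivAt_id x).prodMk hs)
  refine h.congr_fderiv ?_
  ext v
  simp [hA', hB', ← map_add]

variable [NormedAddCommGroup F] [InnerProductSpace ℝ F] [CompleteSpace F]

/-- The partial gradient of a `C²` function is jointly differentiable. -/
theorem differentiable_partial_gradient {f : E → F → ℝ}
    (hf : ContDiff ℝ 2 (fun z : E × F => f z.1 z.2)) {g : E → F → F}
    (hg : ∀ x y, HasGradientAt (f x) (g x y) y) :
    Differentiable ℝ (fun z : E × F => g z.1 z.2) := by
  have h1 : Differentiable ℝ (fderiv ℝ (fun z : E × F => f z.1 z.2)) :=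
    (hf.fderiv_right (m := 1) (by norm_num)).differentiable (by norm_num)
  have h2 : (fun z : E × F => g z.1 z.2) = fun z => (InnerProductSpace.toDual ℝ F).symm
      ((fderiv ℝ (fun z : E × F => f z.1 z.2) z) ∘L ContinuousLinearMap.inr ℝ E F) := by
    funext z
    rw [LinearIsometryEquiv.eq_symm_apply]
    exact (hg z.1 z.2).hasFDerivAt.unique
      (HasFDerivAt.comp z.2 (f := fun y => (z.1, y))
        (hf.differentiable (by norm_num) z).hasFDerivAt (hasFDerivAt_prodMk_right z.1 z.2))
  rw [h2]
  exact (InnerProductSpace.toDual ℝ F).symm.toContinuousLinearEquiv.differentiable.comp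
    (h1.clm_comp (differentiable_const _))

/-- The Hessian, as the derivative of the gradient, is a symmetric operator. -/
theorem inner_hessian_comm {f : F → ℝ} {g : F → F} {H : F →L[ℝ] F} {x : F}
    (hf : ∀ y, HasGradientAt f (g y) y) (hg : HasFDerivAt g H x) (v w : F) :
    inner ℝ (H v) w = inner ℝ v (H w) := by
  have h := second_derivative_symmetric (fun y => (hf y).hasFDerivAt)
    ((InnerProductSpace.toDual ℝ F).toContinuousLinearEquiv.hasFDerivAt.comp x hg) v w
  rw [real_inner_comm (H w) v]
  simpa using h

end Calculus

/-- Implicit differentiation of the log-barrier stationarity condition. -/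
theorem barrier_implicit_deriv {E : Type*} [NormedAddCommGroup E] [NormedSpace ℝ E] {p : ℕ}
    {c : ℝ} {b₁ b₂ : Fin p → ℝ} {s φ : E → EuclideanSpace ℝ (Fin p)}
    {D Φ : E →L[ℝ] EuclideanSpace ℝ (Fin p)} {x : E}
    (hs : HasFDerivAt s D x) (hφ : HasFDerivAt φ Φ x)
    (h₁ : ∀ j, b₁ j - s x j ≠ 0) (h₂ : ∀ j, b₂ j + s x j ≠ 0)
    (hstat : ∀ t j, φ t j + c * ((b₁ j - s t j)⁻¹ - (b₂ j + s t j)⁻¹) = 0) (v : E) :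
    Φ v + diagCLM (fun j => c * (((b₁ j - s x j) ^ 2)⁻¹ + ((b₂ j + s x j) ^ 2)⁻¹)) (D v) = 0 := by
  ext j
  have hsj : HasFDerivAt (fun t => s t j) (EuclideanSpace.proj j ∘L D) x :=
    (EuclideanSpace.proj (𝕜 := ℝ) j).hasFDerivAt.comp x hs
  have hφj : HasFDerivAt (fun t => φ t j) (EuclideanSpace.proj j ∘L Φ) x :=
    (EuclideanSpace.proj (𝕜 := ℝ) j).hasFDerivAt.comp x hφ
  have i₁ := (hasDerivAt_inv (h₁ j)).comp_hasFDerivAt x (hsj.const_sub (b₁ j))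
  have i₂ := (hasDerivAt_inv (h₂ j)).comp_hasFDerivAt x (hsj.const_add (b₂ j))
  have hsum := hφj.add ((i₁.sub i₂).const_mul c)
  have h0 := hsum.unique ((hasFDerivAt_const (0 : ℝ) x).congr_of_eventuallyEq
    (Filter.Eventually.of_forall fun t => hstat t j))
  have h := DFunLike.congr_fun h0 v
  simp only [add_apply, sub_apply,
    smul_apply, neg_apply,
    ContinuousLinearMap.comp_apply, PiLp.proj_apply, smul_eq_mul,
    zero_apply] at h
  simp only [PiLp.add_apply, diagCLM_apply, PiLp.zero_apply]
  linear_combination h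

/-- Proposition 1: gradient of the compositional outer objective
`L(θ) = r log((1/M) ∑ᵢ exp(ℓᵢ(θ, δ̂*ᵢ(θ))/r))`, where each `δ̂*ᵢ(θ)` satisfies
the log-barrier stationarity condition for the attack objective `ℓ'ᵢ` under the
`ℓ∞` constraint `A δ ≤ bᵢ` with `A = (I_p, −I_p)ᵀ`.  In linear-map form,
`∇L(θ) = r ∑ᵢ (∇_θ gᵢ − (∇_θ∇_δ ℓ'ᵢ)ᵀ [∇²_δ ℓ'ᵢ + Cᵢ(θ)]⁻¹ ∇_δ gᵢ) / ∑ᵢ gᵢ`,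
with `gᵢ = exp(ℓᵢ/r)` and `Cᵢ(θ) = c · diag(γ₁ + γ_{p+1}, …, γ_p + γ_{2p})`,
`γ_k = 1/(b_k − a_kᵀ δ̂*ᵢ(θ))²`. -/
theorem stmt_6 (d p M : ℕ) (hM : 1 ≤ M) (r c : ℝ) (hr : 0 < r) (hc : 0 < c)
    (ℓ ℓ' : Fin M → EuclideanSpace ℝ (Fin d) → EuclideanSpace ℝ (Fin p) → ℝ)
    (hℓdiff : ∀ i, Differentiable ℝ
      (fun x : EuclideanSpace ℝ (Fin d) × EuclideanSpace ℝ (Fin p) => ℓ i x.1 x.2))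
    (hℓ'C2 : ∀ i, ContDiff ℝ 2
      (fun x : EuclideanSpace ℝ (Fin d) × EuclideanSpace ℝ (Fin p) => ℓ' i x.1 x.2))
    (b : Fin M → Fin (p + p) → ℝ)
    (δs : Fin M → EuclideanSpace ℝ (Fin d) → EuclideanSpace ℝ (Fin p))
    (hδs : ∀ i, Differentiable ℝ (δs i))
    -- `gradδℓ' i θ δ` is the gradient `∇_δ ℓ'ᵢ(θ, δ)`
    (gradδℓ' : Fin M → EuclideanSpace ℝ (Fin d) → EuclideanSpace ℝ (Fin p) →
      EuclideanSpace ℝ (Fin p))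
    (hgradδℓ' : ∀ i θ δ, HasGradientAt (ℓ' i θ) (gradδℓ' i θ δ) δ)
    -- strict feasibility: `b_k − a_kᵀ δ̂*ᵢ(θ) > 0` for all rows of `A = (I_p, −I_p)ᵀ`
    (hfeas : ∀ i θ (j : Fin p),
      0 < b i (Fin.castAdd p j) - δs i θ j ∧ 0 < b i (Fin.natAdd p j) + δs i θ j)
    -- barrier stationarity `∇_δ ℓ'ᵢ(θ, δ̂*ᵢ(θ)) + c ∑ₖ aₖ/(bₖ − aₖᵀ δ̂*ᵢ(θ)) = 0`
    (hstat : ∀ i θ (j : Fin p),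
      gradδℓ' i θ (δs i θ) j
        + c * ((b i (Fin.castAdd p j) - δs i θ j)⁻¹
          - (b i (Fin.natAdd p j) + δs i θ j)⁻¹) = 0)
    (θ : EuclideanSpace ℝ (Fin d))
    -- partial gradients of `gᵢ(·,·) = exp(ℓᵢ(·,·)/r)` at `(θ, δ̂*ᵢ(θ))`
    (Gθ : Fin M → EuclideanSpace ℝ (Fin d))
    (hGθ : ∀ i, HasGradientAt (fun t => Real.exp (ℓ i t (δs i θ) / r)) (Gθ i) θ)
    (Gδ : Fin M → EuclideanSpace ℝ (Fin p))
    (hGδ : ∀ i, HasGradientAt (fun x => Real.exp (ℓ i θ x / r)) (Gδ i) (δs i θ))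
    -- Hessians `∇²_δ ℓ'ᵢ` and mixed derivatives `∇_θ∇_δ ℓ'ᵢ` at `(θ, δ̂*ᵢ(θ))`
    (Hδδ : Fin M → EuclideanSpace ℝ (Fin p) →L[ℝ] EuclideanSpace ℝ (Fin p))
    (hHδδ : ∀ i, HasFDerivAt (fun x => gradδℓ' i θ x) (Hδδ i) (δs i θ))
    (Mθδ : Fin M → EuclideanSpace ℝ (Fin d) →L[ℝ] EuclideanSpace ℝ (Fin p))
    (hMθδ : ∀ i, HasFDerivAt (fun t => gradδℓ' i t (δs i θ)) (Mθδ i) θ)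
    -- invertibility of `∇²_δ ℓ'ᵢ(θ, δ̂*ᵢ(θ)) + Cᵢ(θ)`
    (E : Fin M → EuclideanSpace ℝ (Fin p) ≃L[ℝ] EuclideanSpace ℝ (Fin p))
    (hE : ∀ i, (E i : EuclideanSpace ℝ (Fin p) →L[ℝ] EuclideanSpace ℝ (Fin p)) =
      Hδδ i + diagCLM (fun j => c * (((b i (Fin.castAdd p j) - δs i θ j) ^ 2)⁻¹
        + ((b i (Fin.natAdd p j) + δs i θ j) ^ 2)⁻¹))) :
    HasGradientAt
      (fun t => r * Real.log ((1 / (M : ℝ)) * ∑ i, Real.exp (ℓ i t (δs i t) / r)))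
      ((r / ∑ i, Real.exp (ℓ i θ (δs i θ) / r)) •
        ∑ i, (Gθ i - (ContinuousLinearMap.adjoint (Mθδ i)) ((E i).symm (Gδ i))))
      θ := by
  have hg : ∀ i, HasGradientAt (fun t => Real.exp (ℓ i t (δs i t) / r))
      (Gθ i - (ContinuousLinearMap.adjoint (Mθδ i)) ((E i).symm (Gδ i))) θ := by
    intro i
    obtain ⟨D, hD⟩ := hδs i θ
    have hgrad := hasFDerivAt_comp_graph
      (differentiable_partial_gradient (hℓ'C2 i) (hgradδℓ' i) (θ, δs i θ))
      (hMθδ i) (hHδδ i) hD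
    have himp : ∀ v, E i (D v) = -(Mθδ i v) := by
      intro v
      have h := barrier_implicit_deriv hD hgrad (fun j => (hfeas i θ j).1.ne')
        (fun j => (hfeas i θ j).2.ne') (hstat i) v
      rw [← ContinuousLinearEquiv.coe_coe, hE i, eq_neg_iff_add_eq_zero, ← h]
      simp only [add_apply, ContinuousLinearMap.comp_apply]
      abel
    have hsymm : ∀ v w, inner ℝ (E i v) w = inner ℝ v (E i w) := by
      intro v w
      rw [← ContinuousLinearEquiv.coe_coe, hE i]
      simp only [add_apply, inner_add_left, inner_add_right,
        inner_hessian_comm (hgradδℓ' i θ) (hHδδ i), diagCLM_inner_comm]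
    have hcomp := hasFDerivAt_comp_graph
      (f := fun t x => Real.exp (ℓ i t x / r)) (s := δs i)
      (((hℓdiff i).mul_const r⁻¹).exp (θ, δs i θ)) (hGθ i).hasFDerivAt (hGδ i).hasFDerivAt hD
    rw [hasGradientAt_iff_hasFDerivAt]
    refine hcomp.congr_fderiv ?_
    ext v
    have hinner : inner ℝ ((E i).symm (Gδ i)) (Mθδ i v) = -inner ℝ (Gδ i) (D v) := by
      have h := hsymm ((E i).symm (Gδ i)) (D v)
      rw [ContinuousLinearEquiv.apply_symm_apply, himp, inner_neg_right] at h
      linarith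
    simp [ContinuousLinearMap.adjoint_inner_left, hinner]
  have hM' : (0 : ℝ) < M := by exact_mod_cast hM
  have hpos : 0 < ∑ i, Real.exp (ℓ i θ (δs i θ) / r) :=
    Finset.sum_pos (fun i _ => Real.exp_pos _) ⟨⟨0, hM⟩, Finset.mem_univ _⟩
  have hsum := HasFDerivAt.fun_sum fun i (_ : i ∈ Finset.univ) => (hg i).hasFDerivAt
  have hlog := ((hsum.const_mul (1 / (M : ℝ))).log (by positivity)).const_mul r
  rw [hasGradientAt_iff_hasFDerivAt]
  refine hlog.congr_fderiv ?_
  rw [map_smul, map_sum, smul_smul, smul_smul]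
  congr 1
  field_simp
end

section
/- Let V ⊆ ℝ^p be a nonempty closed convex set, h : ℝ^d × ℝ^p → ℝ differentiable in δ such that for every θ the function h(θ, ·) is μ-strongly convex with L-Lipschitz gradient (0 < μ ≤ L), and such that θ ↦ ∇_δ h(θ, δ) is L-Lipschitz uniformly in δ, i.e., ‖∇_δ h(θ, δ) − ∇_δ h(θ', δ)‖ ≤ L‖θ − θ'‖. Fix δ^0 ∈ V and stepsize α = 2/(L + μ), and for each θ define the projected gradient iterates δ^k(θ) = Π_V(δ^{k−1}(θ) − α∇_δ h(θ, δ^{k−1}(θ))) with δ^0(θ) = δ^0. Then for every K ≥ 0 and all θ, θ' ∈ ℝ^d, ‖δ^K(θ) − δ^K(θ')‖ ≤ κ ‖θ − θ'‖, where κ = αL / (1 − (L − μ)/(L + μ)) = L/μ. -/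
open scoped RealInnerProductSpace

section ProjectedGradient

variable {E : Type*} [NormedAddCommGroup E] [InnerProductSpace ℝ E]

theorem inner_sub_metricProjection_nonpos {V : Set E} (hV : Convex ℝ V) {x p : E} (hp : p ∈ V)
    (hmin : ∀ y ∈ V, ‖x - p‖ ≤ ‖x - y‖) {y : E} (hy : y ∈ V) : ⟪x - p, y - p⟫ ≤ 0 := by
  have : Nonempty V := ⟨⟨p, hp⟩⟩
  refine (norm_eq_iInf_iff_real_inner_le_zero hV hp).1 (le_antisymm ?_ ?_) y hy
  · exact le_ciInf fun w => hmin w w.2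
  · exact ciInf_le ⟨0, by rintro _ ⟨w, rfl⟩; exact norm_nonneg _⟩ (⟨p, hp⟩ : V)

theorem norm_metricProjection_sub_le {V : Set E} (hV : Convex ℝ V) {proj : E → E}
    (hproj : ∀ x, proj x ∈ V ∧ ∀ y ∈ V, ‖x - proj x‖ ≤ ‖x - y‖) (x y : E) :
    ‖proj x - proj y‖ ≤ ‖x - y‖ := by
  have h₁ := inner_sub_metricProjection_nonpos hV (hproj x).1 (hproj x).2 (hproj y).1
  have h₂ := inner_sub_metricProjection_nonpos hV (hproj y).1 (hproj y).2 (hproj x).1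
  have key : ‖proj x - proj y‖ ^ 2 ≤ ⟪x - y, proj x - proj y⟫ := by
    have e : ⟪x - y, proj x - proj y⟫ - ⟪proj x - proj y, proj x - proj y⟫
        = -⟪x - proj x, proj y - proj x⟫ - ⟪y - proj y, proj x - proj y⟫ := by
      simp only [inner_sub_left, inner_sub_right]
      ring
    rw [real_inner_self_eq_norm_sq] at e
    linarith
  have := real_inner_le_norm (x - y) (proj x - proj y)
  by_contra! hlt
  nlinarith [norm_nonneg (x - y), norm_nonneg (proj x - proj y)]

/-- The descent lemma for a function with `L`-Lipschitz gradient. -/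
theorem le_quadratic_of_lipschitz_gradient [CompleteSpace E] {f : E → ℝ} {g : E → E} {L : ℝ}
    (hg : ∀ x, HasGradientAt f (g x) x) (hL : ∀ x y, ‖g x - g y‖ ≤ L * ‖x - y‖) (x y : E) :
    f y ≤ f x + ⟪g x, y - x⟫ + L / 2 * ‖y - x‖ ^ 2 := by
  set v := y - x with hv
  have hline : ∀ t : ℝ, HasDerivAt (fun t : ℝ => x + t • v) v t := fun t => by
    simpa using ((hasDerivAt_id t).smul_const v).const_add x
  have hf : ∀ t : ℝ, HasDerivAt (fun t : ℝ => f (x + t • v)) ⟪g (x + t • v), v⟫ t := fun t => by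
    simpa [Function.comp_def] using (hg (x + t • v)).hasFDerivAt.comp_hasDerivAt t (hline t)
  have hψ : ∀ t : ℝ, HasDerivAt
      (fun t : ℝ => f (x + t • v) - (t * ⟪g x, v⟫ + L / 2 * ‖v‖ ^ 2 * t ^ 2))
      (⟪g (x + t • v), v⟫ - (⟪g x, v⟫ + L * ‖v‖ ^ 2 * t)) t := fun t => by
    refine ((hf t).sub (((hasDerivAt_id t).mul_const ⟪g x, v⟫).add
      ((hasDerivAt_pow 2 t).const_mul (L / 2 * ‖v‖ ^ 2)))).congr_deriv ?_
    push_cast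
    ring
  have hanti := antitoneOn_of_deriv_nonpos (convex_Icc (0 : ℝ) 1)
    (fun t _ => (hψ t).continuousAt.continuousWithinAt)
    (fun t _ => (hψ t).differentiableAt.differentiableWithinAt) (fun t ht => by
      rw [interior_Icc] at ht
      rw [(hψ t).deriv]
      have h₁ := real_inner_le_norm (g (x + t • v) - g x) v
      have h₂ := hL (x + t • v) x
      rw [add_sub_cancel_left, norm_smul, Real.norm_of_nonneg ht.1.le] at h₂
      rw [inner_sub_left] at h₁
      nlinarith [mul_le_mul_of_nonneg_right h₂ (norm_nonneg v)])
  have := hanti (Set.left_mem_Icc.2 zero_le_one) (Set.right_mem_Icc.2 zero_le_one) zero_le_one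
  simp only [one_smul, zero_smul, add_zero, hv, add_sub_cancel] at this
  simp only [hv]
  linarith

/-- Cocoercivity of the shifted gradient `g - μ • id` of a `μ`-strongly convex function
satisfying the quadratic upper bound with constant `L`. -/
theorem norm_sq_gradient_sub_le_of_strongConvex {f : E → ℝ} {g : E → E} {μ L : ℝ} (hμL : μ ≤ L)
    (hsc : ∀ x y, f x + ⟪g x, y - x⟫ + μ / 2 * ‖y - x‖ ^ 2 ≤ f y)
    (hsm : ∀ x y, f y ≤ f x + ⟪g x, y - x⟫ + L / 2 * ‖y - x‖ ^ 2) (x y : E) :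
    ‖g x - g y - μ • (x - y)‖ ^ 2 ≤ (L - μ) * ⟪g x - g y - μ • (x - y), x - y⟫ := by
  have bregman : ∀ (t : ℝ) (x y : E),
      (t - (L - μ) / 2 * t ^ 2) * ‖g x - g y - μ • (x - y)‖ ^ 2
        ≤ f y - f x - ⟪g x, y - x⟫ - μ / 2 * ‖y - x‖ ^ 2 := fun t x y => by
    have h₁ := hsc x (y + t • (g x - g y - μ • (x - y)))
    have h₂ := hsm y (y + t • (g x - g y - μ • (x - y)))
    set w := g x - g y - μ • (x - y) with hw
    have e₁ : y + t • w - x = (y - x) + t • w := by abel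
    have e₂ : ⟪g x, w⟫ - ⟪g y, w⟫ + μ * ⟪y - x, w⟫ = ‖w‖ ^ 2 := by
      rw [← real_inner_self_eq_norm_sq]
      conv_rhs => rw [hw, inner_sub_left, inner_sub_left, real_inner_smul_left]
      simp only [inner_sub_left]
      ring
    rw [e₁, norm_add_sq_real, inner_add_right, norm_smul, mul_pow, Real.norm_eq_abs, sq_abs,
      real_inner_smul_right, real_inner_smul_right] at h₁
    rw [add_sub_cancel_left, norm_smul, mul_pow, Real.norm_eq_abs, sq_abs,
      real_inner_smul_right] at h₂
    linear_combination h₁ + h₂ - t * e₂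
  have key : ∀ t : ℝ, (2 * t - (L - μ) * t ^ 2) * ‖g x - g y - μ • (x - y)‖ ^ 2
      ≤ ⟪g x - g y - μ • (x - y), x - y⟫ := fun t => by
    have h₁ := bregman t x y
    have h₂ := bregman t y x
    have e₁ : g y - g x - μ • (y - x) = -(g x - g y - μ • (x - y)) := by
      rw [← neg_sub x y, smul_neg]; abel
    have e₂ : ⟪g x - g y - μ • (x - y), x - y⟫
        = -⟪g x, y - x⟫ - ⟪g y, x - y⟫ - μ * ‖x - y‖ ^ 2 := by
      rw [← neg_sub x y, inner_neg_right, inner_sub_left, inner_sub_left, real_inner_smul_left,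
        real_inner_self_eq_norm_sq]
      ring
    rw [e₁, norm_neg] at h₂
    rw [norm_sub_rev y x] at h₁
    rw [e₂]
    linarith
  set w := g x - g y - μ • (x - y)
  rcases hμL.eq_or_lt with rfl | hlt
  · simp only [sub_self, zero_mul, sub_zero] at key ⊢
    by_contra! hpos
    have hw : ‖w‖ ≠ 0 := (pow_ne_zero_iff two_ne_zero).1 hpos.ne'
    have h := key ((⟪w, x - y⟫ + 1) / (2 * ‖w‖ ^ 2))
    have : 2 * ((⟪w, x - y⟫ + 1) / (2 * ‖w‖ ^ 2)) * ‖w‖ ^ 2 = ⟪w, x - y⟫ + 1 := by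
      field_simp
    linarith
  · have hM : 0 < L - μ := sub_pos.2 hlt
    have h := mul_le_mul_of_nonneg_left (key (1 / (L - μ))) hM.le
    have : (L - μ) * ((2 * (1 / (L - μ)) - (L - μ) * (1 / (L - μ)) ^ 2) * ‖w‖ ^ 2) = ‖w‖ ^ 2 := by
      field_simp
      ring
    linarith

/-- A gradient step with stepsize `2 / (L + μ)` is a contraction. -/
theorem norm_gradientStep_sub_le [CompleteSpace E] {f : E → ℝ} {g : E → E} {μ L : ℝ} (hμ : 0 < μ)
    (hμL : μ ≤ L) (hg : ∀ x, HasGradientAt f (g x) x)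
    (hsc : ∀ x y, f x + ⟪g x, y - x⟫ + μ / 2 * ‖y - x‖ ^ 2 ≤ f y)
    (hL : ∀ x y, ‖g x - g y‖ ≤ L * ‖x - y‖) (x y : E) :
    ‖(x - (2 / (L + μ)) • g x) - (y - (2 / (L + μ)) • g y)‖
      ≤ (L - μ) / (L + μ) * ‖x - y‖ := by
  have hpos : 0 < L + μ := by linarith
  have hco := norm_sq_gradient_sub_le_of_strongConvex hμL hsc
    (le_quadratic_of_lipschitz_gradient hg hL) x y
  set w := g x - g y - μ • (x - y) with hw
  have e : (x - (2 / (L + μ)) • g x) - (y - (2 / (L + μ)) • g y)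
      = (L + μ)⁻¹ • ((L - μ) • (x - y) - (2 : ℝ) • w) := by
    rw [hw]
    match_scalars <;> field_simp <;> ring
  have hle : ‖(L - μ) • (x - y) - (2 : ℝ) • w‖ ≤ (L - μ) * ‖x - y‖ := by
    refine le_of_sq_le_sq ?_ (mul_nonneg (sub_nonneg.2 hμL) (norm_nonneg _))
    rw [norm_sub_sq_real, norm_smul, norm_smul, real_inner_smul_left, real_inner_smul_right,
      real_inner_comm, mul_pow, mul_pow, Real.norm_eq_abs, sq_abs, Real.norm_eq_abs, sq_abs]
    linarith
  rw [e, norm_smul, Real.norm_of_nonneg (inv_nonneg.2 hpos.le), div_eq_inv_mul, mul_assoc]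
  exact mul_le_mul_of_nonneg_left hle (inv_nonneg.2 hpos.le)

end ProjectedGradient


/-- The `K`-th projected gradient descent iterate on `h(θ, ·)` (started from a
common initialization `δ⁰` and run with stepsize `α = 2/(L+μ)`) is a
`κ`-Lipschitz function of `θ`, with `κ = αL/(1 − (L−μ)/(L+μ)) = L/μ`. -/
theorem stmt_9 (d p : ℕ) (V : Set (EuclideanSpace ℝ (Fin p)))
    (hVne : V.Nonempty) (hVcl : IsClosed V) (hVcv : Convex ℝ V)
    (h : EuclideanSpace ℝ (Fin d) → EuclideanSpace ℝ (Fin p) → ℝ)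
    (g : EuclideanSpace ℝ (Fin d) → EuclideanSpace ℝ (Fin p) → EuclideanSpace ℝ (Fin p))
    (μ L : ℝ) (hμ : 0 < μ) (hμL : μ ≤ L)
    (hgrad : ∀ θ δ, HasGradientAt (h θ) (g θ δ) δ)
    (hsconv : ∀ θ δ δ', h θ δ + ⟪g θ δ, δ' - δ⟫ + μ / 2 * ‖δ' - δ‖ ^ 2 ≤ h θ δ')
    (hlipδ : ∀ θ δ δ', ‖g θ δ - g θ δ'‖ ≤ L * ‖δ - δ'‖)
    (hlipθ : ∀ θ θ' δ, ‖g θ δ - g θ' δ‖ ≤ L * ‖θ - θ'‖)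
    -- metric projection onto `V`
    (proj : EuclideanSpace ℝ (Fin p) → EuclideanSpace ℝ (Fin p))
    (hproj : ∀ x, proj x ∈ V ∧ ∀ y ∈ V, ‖x - proj x‖ ≤ ‖x - y‖)
    -- projected gradient iterates from the common initialization `δ0 ∈ V`
    (δ0 : EuclideanSpace ℝ (Fin p)) (hδ0 : δ0 ∈ V)
    (δit : EuclideanSpace ℝ (Fin d) → ℕ → EuclideanSpace ℝ (Fin p))
    (hinit : ∀ θ, δit θ 0 = δ0)
    (hrec : ∀ θ k, δit θ (k + 1) = proj (δit θ k - (2 / (L + μ)) • g θ (δit θ k))) :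
    ∀ (K : ℕ) (θ θ' : EuclideanSpace ℝ (Fin d)),
      ‖δit θ K - δit θ' K‖ ≤ L / μ * ‖θ - θ'‖ := by
  intro K θ θ'
  have hpos : 0 < L + μ := by linarith
  induction K with
  | zero =>
    rw [hinit, hinit, sub_self, norm_zero]
    exact mul_nonneg (div_nonneg (hμ.le.trans hμL) hμ.le) (norm_nonneg _)
  | succ k ih =>
    rw [hrec, hrec]
    set x := δit θ k
    set y := δit θ' k
    have hstep := norm_gradientStep_sub_le hμ hμL (hgrad θ) (hsconv θ) (hlipδ θ) x y
    have hpert : ‖(y - (2 / (L + μ)) • g θ y) - (y - (2 / (L + μ)) • g θ' y)‖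
        ≤ 2 / (L + μ) * (L * ‖θ - θ'‖) := by
      rw [sub_sub_sub_cancel_left, ← smul_sub, norm_smul,
        Real.norm_of_nonneg (div_nonneg zero_le_two hpos.le), norm_sub_rev]
      exact mul_le_mul_of_nonneg_left (hlipθ θ θ' y) (div_nonneg zero_le_two hpos.le)
    have hcontr : (L - μ) / (L + μ) * ‖x - y‖ ≤ (L - μ) / (L + μ) * (L / μ * ‖θ - θ'‖) :=
      mul_le_mul_of_nonneg_left ih (div_nonneg (sub_nonneg.2 hμL) hpos.le)
    calc _ ≤ ‖(x - (2 / (L + μ)) • g θ x) - (y - (2 / (L + μ)) • g θ' y)‖ :=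
          norm_metricProjection_sub_le hVcv hproj _ _
      _ ≤ _ := norm_sub_le_norm_sub_add_norm_sub _ (y - (2 / (L + μ)) • g θ y) _
      _ ≤ (L - μ) / (L + μ) * (L / μ * ‖θ - θ'‖) + 2 / (L + μ) * (L * ‖θ - θ'‖) :=
          add_le_add (hstep.trans hcontr) hpert
      _ = L / μ * ‖θ - θ'‖ := by field_simp; ring
end
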